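/- Let G be a powerful p-group for an odd prime p, let N ≤ G^p, and suppose N has exponent at most p^2. Then every element of order p in N is central in N. -/

import Mathlib

/-- For a subgroup `H` of `G`, the subgroup generated by `n`-th powers of elements of `H`. -/
def sgPow {G : Type*} [Group G] (H : Subgroup G) (n : ℕ) : Subgroup G :=
  Subgroup.closure {x | ∃ h ∈ H, h ^ n = x}

open scoped commutatorElement

/-- If the commutator `d` of `c` and `u` commutes with both, then `(u * c) ^ n` can be collected. -/
lemma mul_pow_eq_of_commutator_commute {G : Type*} [Group G] {u c d : G} (h : c * u = u * c * d)
    (hu : Commute d u) (hc : Commute d c) (n : ℕ) :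
    (u * c) ^ n = u ^ n * c ^ n * d ^ n.choose 2 := by
  have key : ∀ m : ℕ, c ^ m * u = u * c ^ m * d ^ m := by
    intro m
    induction m with
    | zero => simp
    | succ m ih =>
      calc c ^ (m + 1) * u = c ^ m * (c * u) := by rw [pow_succ, mul_assoc]
        _ = (c ^ m * u) * c * d := by rw [h]; simp only [mul_assoc]
        _ = u * c ^ m * (d ^ m * c) * d := by rw [ih]; simp only [mul_assoc]
        _ = u * c ^ (m + 1) * d ^ (m + 1) := by
          rw [(hc.pow_left m).eq, pow_succ, pow_succ]; simp only [mul_assoc]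
  induction n with
  | zero => simp
  | succ n ih =>
    have huc : Commute (d ^ n.choose 2) (u * c) := (hu.mul_right hc).pow_left _
    calc (u * c) ^ (n + 1) = u ^ n * c ^ n * (d ^ n.choose 2 * (u * c)) := by
          rw [pow_succ, ih]; simp only [mul_assoc]
      _ = u ^ n * (c ^ n * u) * c * d ^ n.choose 2 := by rw [huc.eq]; simp only [mul_assoc]
      _ = u ^ n * u * c ^ n * (d ^ n * c) * d ^ n.choose 2 := by rw [key]; simp only [mul_assoc]
      _ = u ^ (n + 1) * c ^ (n + 1) * d ^ (n + 1).choose 2 := by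
        have : (n + 1).choose 2 = n + n.choose 2 := by
          rw [Nat.choose_succ_succ' n 1, Nat.choose_one_right]
        rw [(hc.pow_left n).eq, this, pow_add d, pow_succ u n, pow_succ c n]; simp only [mul_assoc]

lemma mul_pow_of_odd_of_commutator_commute {G : Type*} [Group G] {n : ℕ} (hn : Odd n)
    {u c d : G} (h : c * u = u * c * d) (hu : Commute d u) (hc : Commute d c) (hd : d ^ n = 1) :
    (u * c) ^ n = u ^ n * c ^ n := by
  obtain ⟨k, rfl⟩ := hn
  have : (2 * k + 1).choose 2 = (2 * k + 1) * k := by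
    rw [Nat.choose_two_right, Nat.add_sub_cancel, mul_left_comm]
    exact Nat.mul_div_cancel_left _ two_pos
  rw [mul_pow_eq_of_commutator_commute h hu hc, this, pow_mul, hd, one_pow, mul_one]

lemma commutator_pow_eq_one_of_odd {G : Type*} [Group G] {n : ℕ} (hn : Odd n) {v y : G}
    (hc : ⁅v, y⁆ ^ n = 1) (hdv : Commute ⁅⁅v, y⁆⁻¹, v⁆ v)
    (hdc : Commute ⁅⁅v, y⁆⁻¹, v⁆ ⁅v, y⁆) : ⁅v ^ n, y⁆ = 1 := by
  set c := ⁅v, y⁆ with hcdef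
  set d := ⁅c⁻¹, v⁆ with hddef
  have hd : d ^ n = 1 := by
    have h1 : v * c * v⁻¹ = c * d := by rw [hddef, commutatorElement_def]; group
    have h2 : (c * d) ^ n = c ^ n * d ^ n := hdc.symm.mul_pow n
    rw [← h1, conj_pow, hc, one_mul, mul_one, mul_inv_cancel] at h2
    exact h2.symm
  have h : c * v⁻¹ = v⁻¹ * c * d := by rw [hddef, commutatorElement_def]; group
  have h3 := mul_pow_of_odd_of_commutator_commute hn h hdv.inv_right hdc hd
  have h4 : v⁻¹ * c = y * v⁻¹ * y⁻¹ := by rw [hcdef, commutatorElement_def]; group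
  rw [h4, conj_pow, hc, mul_one, inv_pow] at h3
  rw [commutatorElement_def, mul_assoc, mul_assoc, ← mul_assoc y, h3, mul_inv_cancel]

lemma commutator_mem_iff_commute_mk {G : Type*} [Group G] (M : Subgroup G) [M.Normal] {a b : G} :
    ⁅a, b⁆ ∈ M ↔ Commute (a : G ⧸ M) b := by
  rw [← commutatorElement_eq_one_iff_commute, ← QuotientGroup.eq_one_iff]
  rfl

lemma commutator_pow_mem_of_odd {G : Type*} [Group G] {n : ℕ} (hn : Odd n) (M : Subgroup G)
    [M.Normal] {v y : G} (hc : ⁅v, y⁆ ^ n ∈ M) (hdv : ⁅⁅⁅v, y⁆⁻¹, v⁆, v⁆ ∈ M)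
    (hdc : ⁅⁅⁅v, y⁆⁻¹, v⁆, ⁅v, y⁆⁆ ∈ M) : ⁅v ^ n, y⁆ ∈ M := by
  rw [commutator_mem_iff_commute_mk] at hdv hdc
  rw [← QuotientGroup.eq_one_iff] at hc ⊢
  exact commutator_pow_eq_one_of_odd (v := (v : G ⧸ M)) (y := (y : G ⧸ M)) hn hc hdv hdc

lemma mul_pow_mem_of_odd {G : Type*} [Group G] {n : ℕ} (hn : Odd n) (M : Subgroup G)
    [M.Normal] {x y : G} (hd : ⁅y⁻¹, x⁻¹⁆ ^ n ∈ M) (hdx : ⁅⁅y⁻¹, x⁻¹⁆, x⁆ ∈ M)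
    (hdy : ⁅⁅y⁻¹, x⁻¹⁆, y⁆ ∈ M) : ∃ m ∈ M, (x * y) ^ n = x ^ n * y ^ n * m := by
  rw [commutator_mem_iff_commute_mk] at hdx hdy
  rw [← QuotientGroup.eq_one_iff] at hd
  have h : (y : G ⧸ M) * x = x * y * ((⁅y⁻¹, x⁻¹⁆ : G) : G ⧸ M) := by
    rw [← QuotientGroup.mk_mul, ← QuotientGroup.mk_mul, ← QuotientGroup.mk_mul,
      commutatorElement_def]
    congr 1
    group
  have := mul_pow_of_odd_of_commutator_commute hn h hdx hdy hd
  refine ⟨(x ^ n * y ^ n)⁻¹ * (x * y) ^ n, ?_, by group⟩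
  exact QuotientGroup.eq.mp this.symm

lemma sgPow_le {G : Type*} [Group G] (H : Subgroup G) (n : ℕ) : sgPow H n ≤ H := by
  rw [sgPow, Subgroup.closure_le]
  rintro _ ⟨h, hh, rfl⟩
  exact H.pow_mem hh n

lemma sgPow_mono {G : Type*} [Group G] {H K : Subgroup G} (h : H ≤ K) (n : ℕ) :
    sgPow H n ≤ sgPow K n :=
  Subgroup.closure_mono fun _ ⟨a, ha, e⟩ => ⟨a, h ha, e⟩

lemma pow_mem_sgPow {G : Type*} [Group G] {H : Subgroup G} {x : G} (hx : x ∈ H) (n : ℕ) :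
    x ^ n ∈ sgPow H n :=
  Subgroup.subset_closure ⟨x, hx, rfl⟩

lemma map_sgPow {G K : Type*} [Group G] [Group K] (f : G →* K) (H : Subgroup G) (n : ℕ) :
    (sgPow H n).map f = sgPow (H.map f) n := by
  rw [sgPow, sgPow, MonoidHom.map_closure]
  congr 1
  ext x
  constructor
  · rintro ⟨_, ⟨h, hh, rfl⟩, rfl⟩
    exact ⟨f h, ⟨h, hh, rfl⟩, (map_pow f h n).symm⟩
  · rintro ⟨_, ⟨h, hh, rfl⟩, rfl⟩
    exact ⟨h ^ n, ⟨h, hh, rfl⟩, map_pow f h n⟩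

instance sgPow_normal {G : Type*} [Group G] (H : Subgroup G) [H.Normal] (n : ℕ) :
    (sgPow H n).Normal := by
  refine ⟨fun x hx g => ?_⟩
  have h : (sgPow H n).map (MulAut.conj g).toMonoidHom = sgPow H n := by
    rw [map_sgPow]
    congr 1
    exact Subgroup.Normal.map_conj_eq H g
  rw [← h]
  exact ⟨x, hx, rfl⟩

lemma commutator_top_le_sgPow_top {G : Type*} [Group G] {n : ℕ} {H : Subgroup G}
    (h : ⁅H, H⁆ ≤ sgPow H n) : ⁅(⊤ : Subgroup H), (⊤ : Subgroup H)⁆ ≤ sgPow ⊤ n := by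
  rw [← Subgroup.map_le_map_iff_of_injective H.subtype_injective, Subgroup.map_commutator,
    map_sgPow, ← MonoidHom.range_eq_map, H.range_subtype]
  exact h

lemma commutator_top_le_iff_le_comap_center {G : Type*} [Group G] {K M : Subgroup G} [M.Normal] :
    ⁅K, ⊤⁆ ≤ M ↔ K ≤ (Subgroup.center (G ⧸ M)).comap (QuotientGroup.mk' M) := by
  rw [Subgroup.commutator_le]
  refine forall₂_congr fun x _ => ?_
  rw [Subgroup.mem_comap, Subgroup.mem_center_iff]
  constructor
  · intro h y
    obtain ⟨y, rfl⟩ := QuotientGroup.mk_surjective y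
    exact ((commutator_mem_iff_commute_mk M).mp (h y (Subgroup.mem_top y))).symm
  · intro h y _
    exact (commutator_mem_iff_commute_mk M).mpr (h y).symm

lemma le_of_le_sup_commutator {G : Type*} [Group G] [Group.IsNilpotent G] {K L : Subgroup G}
    [L.Normal] (h : K ≤ L ⊔ ⁅K, ⊤⁆) : K ≤ L := by
  obtain ⟨n, hn⟩ := Subgroup.nilpotent_iff_lowerCentralSeries.mp ‹Group.IsNilpotent G›
  have key : ∀ m, K ≤ L ⊔ (⊤ : Subgroup G).lowerCentralSeries m := by
    intro m
    induction m with
    | zero => exact le_sup_of_le_right le_top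
    | succ m ih =>
      refine h.trans (sup_le le_sup_left ((Subgroup.commutator_mono ih le_rfl).trans ?_))
      rw [commutator_top_le_iff_le_comap_center]
      refine sup_le ?_ ?_ <;> rw [← commutator_top_le_iff_le_comap_center]
      · exact (Subgroup.commutator_le_left L ⊤).trans le_sup_left
      · exact le_sup_right
  simpa [hn] using key n

lemma commutator_sgPow_le {G : Type*} [Group G] [Group.IsNilpotent G] {n : ℕ} (hn : Odd n)
    (N : Subgroup G) [N.Normal] (h : ⁅N, (⊤ : Subgroup G)⁆ ≤ sgPow N n) :
    ⁅sgPow N n, (⊤ : Subgroup G)⁆ ≤ sgPow (sgPow N n) n := by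
  apply le_of_le_sup_commutator
  rw [commutator_top_le_iff_le_comap_center]
  refine (Subgroup.closure_le _).mpr ?_
  rintro _ ⟨v, hv, rfl⟩
  set M := sgPow (sgPow N n) n ⊔ ⁅⁅sgPow N n, (⊤ : Subgroup G)⁆, (⊤ : Subgroup G)⁆
  have h2 : ∀ d ∈ ⁅sgPow N n, (⊤ : Subgroup G)⁆, ∀ g, ⁅d, g⁆ ∈ M := fun d hd g =>
    Subgroup.mem_sup_right (Subgroup.commutator_mem_commutator hd (Subgroup.mem_top g))
  rw [SetLike.mem_coe, Subgroup.mem_comap, Subgroup.mem_center_iff]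
  intro y
  obtain ⟨y, rfl⟩ := QuotientGroup.mk_surjective y
  have hc : ⁅v, y⁆ ∈ sgPow N n := h (Subgroup.commutator_mem_commutator hv (Subgroup.mem_top y))
  have hd : ⁅⁅v, y⁆⁻¹, v⁆ ∈ ⁅sgPow N n, (⊤ : Subgroup G)⁆ :=
    Subgroup.commutator_mem_commutator (inv_mem hc) (Subgroup.mem_top v)
  exact ((commutator_mem_iff_commute_mk M).mp (commutator_pow_mem_of_odd hn M
    (Subgroup.mem_sup_left (pow_mem_sgPow hc n)) (h2 _ hd _) (h2 _ hd _))).symm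

/-- The iterated subgroups of `n`-th powers. -/
def sgPowIter (G : Type*) [Group G] (n : ℕ) : ℕ → Subgroup G
  | 0 => ⊤
  | j + 1 => sgPow (sgPowIter G n j) n

instance sgPowIter_normal (G : Type*) [Group G] (n j : ℕ) : (sgPowIter G n j).Normal := by
  induction j with
  | zero => exact Subgroup.normal_top
  | succ j ih => exact sgPow_normal _ n

lemma sgPowIter_antitone (G : Type*) [Group G] (n : ℕ) : Antitone (sgPowIter G n) :=
  antitone_nat_of_succ_le fun j => sgPow_le (sgPowIter G n j) n

lemma commutator_sgPowIter_le {G : Type*} [Group G] [Group.IsNilpotent G] {n : ℕ} (hn : Odd n)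
    (h : ⁅(⊤ : Subgroup G), (⊤ : Subgroup G)⁆ ≤ sgPow ⊤ n) (j : ℕ) :
    ⁅sgPowIter G n j, (⊤ : Subgroup G)⁆ ≤ sgPowIter G n (j + 1) := by
  induction j with
  | zero => exact h
  | succ j ih => exact commutator_sgPow_le hn _ ih

lemma pow_mem_of_isCoatom {G : Type*} [Group G] {p : ℕ} [Fact p.Prime] [Finite G]
    (hG : IsPGroup p G) {M : Subgroup G} (hM : IsCoatom M) (x : G) : x ^ p ∈ M := by
  have := hG.isNilpotent
  have hMn : M.Normal := Subgroup.NormalizerCondition.normal_of_coatom M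
    Group.normalizerCondition_of_isNilpotent hM
  by_contra hx
  have htop : Subgroup.zpowers (x ^ p) ⊔ M = ⊤ := hM.2 _ <| lt_of_le_of_ne le_sup_right fun e =>
    hx (e ▸ Subgroup.mem_sup_left (Subgroup.mem_zpowers _))
  obtain ⟨_, ⟨k, rfl⟩, m, hm, hxz⟩ :=
    Subgroup.mem_sup_of_normal_right.mp (htop ▸ Subgroup.mem_top x : x ∈ Subgroup.zpowers (x ^ p) ⊔ M)
  have hq : ((x : G ⧸ M) ^ p) ^ k = x := by
    have := congrArg (QuotientGroup.mk' M) hxz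
    simpa [(QuotientGroup.eq_one_iff m).mpr hm] using this
  have hq' : ∀ r : ℕ, ((x : G ⧸ M) ^ p ^ r) ^ k ^ r = x := by
    intro r
    induction r with
    | zero => simp
    | succ r ih =>
      calc ((x : G ⧸ M) ^ p ^ (r + 1)) ^ k ^ (r + 1)
          = (((x : G ⧸ M) ^ p ^ r) ^ k ^ r) ^ (p * k) := by
            rw [← zpow_natCast, ← zpow_natCast, ← zpow_mul, ← zpow_mul, ← zpow_mul]
            congr 1
            push_cast
            ring
        _ = x := by rw [ih, zpow_mul, zpow_natCast, hq]
  obtain ⟨r, hr⟩ := hG x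
  have hx1 : (x : G ⧸ M) = 1 := by
    rw [← hq' r, ← QuotientGroup.mk_pow, hr, QuotientGroup.mk_one, one_zpow]
  exact hx (M.pow_mem ((QuotientGroup.eq_one_iff x).mp hx1) p)

lemma eq_top_of_sup_sgPow_eq_top {G : Type*} [Group G] {p : ℕ} [Fact p.Prime] [Finite G]
    (hG : IsPGroup p G) {K : Subgroup G} (h : K ⊔ sgPow ⊤ p = ⊤) : K = ⊤ := by
  by_contra hK
  obtain ⟨M, hM, hKM⟩ := (eq_top_or_exists_le_coatom K).resolve_left hK
  refine hM.1 (top_le_iff.mp (h ▸ sup_le hKM ?_))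
  rw [sgPow, Subgroup.closure_le]
  rintro _ ⟨x, -, rfl⟩
  exact pow_mem_of_isCoatom hG hM x

lemma mul_comm_or_zpowers_sup_ne_top {G : Type*} [Group G] {p : ℕ} [Fact p.Prime] [Finite G]
    (hG : IsPGroup p G) (y : G) :
    (∀ a b : G, a * b = b * a) ∨ Subgroup.zpowers y ⊔ sgPow ⊤ p ≠ ⊤ := by
  refine or_iff_not_imp_right.mpr fun h a b => ?_
  have htop := eq_top_of_sup_sgPow_eq_top hG (not_not.mp h)
  obtain ⟨i, rfl⟩ : a ∈ Subgroup.zpowers y := htop ▸ Subgroup.mem_top a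
  obtain ⟨j, rfl⟩ : b ∈ Subgroup.zpowers y := htop ▸ Subgroup.mem_top b
  exact zpow_mul_comm y i j

lemma commutator_zpowers_sup_le {G : Type*} [Group G] [Group.IsNilpotent G] {n : ℕ} (hn : Odd n)
    (h : ⁅(⊤ : Subgroup G), (⊤ : Subgroup G)⁆ ≤ sgPow ⊤ n) (y : G) :
    ⁅Subgroup.zpowers y ⊔ sgPow ⊤ n, Subgroup.zpowers y ⊔ sgPow ⊤ n⁆ ≤
      sgPow (Subgroup.zpowers y ⊔ sgPow ⊤ n) n := by
  refine le_trans ?_ (sgPow_mono le_sup_right n)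
  set M := sgPow (sgPow (⊤ : Subgroup G) n) n
  have hc : ∀ g ∈ sgPow (⊤ : Subgroup G) n, ∀ x : G, Commute (g : G ⧸ M) x := fun g hg x =>
    (commutator_mem_iff_commute_mk M).mp (commutator_sgPowIter_le hn h 1
      (Subgroup.commutator_mem_commutator hg (Subgroup.mem_top x)))
  rw [Subgroup.commutator_le]
  intro a ha b hb
  obtain ⟨_, ⟨i, rfl⟩, g, hg, rfl⟩ := Subgroup.mem_sup_of_normal_right.mp ha
  obtain ⟨_, ⟨j, rfl⟩, k, hk, rfl⟩ := Subgroup.mem_sup_of_normal_right.mp hb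
  rw [commutator_mem_iff_commute_mk]
  have h1 : Commute ((y ^ i : G) : G ⧸ M) ((y ^ j : G) : G ⧸ M) :=
    ((Commute.refl y).zpow_zpow i j).map (QuotientGroup.mk' M)
  exact (h1.mul_right (hc k hk _).symm).mul_left (hc g hg _)

lemma exists_pow_eq_of_mem_sgPow (p : ℕ) [Fact p.Prime] (hp : Odd p) (n : ℕ) :
    ∀ (G : Type*) [Group G] [Finite G], Nat.card G = n → IsPGroup p G →
      ⁅(⊤ : Subgroup G), (⊤ : Subgroup G)⁆ ≤ sgPow ⊤ p →
      ∀ x ∈ sgPow (⊤ : Subgroup G) p, ∃ v, v ^ p = x := by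
  induction n using Nat.strong_induction_on with
  | _ n ih =>
    intro G _ _ hn hG h x hx
    have := hG.isNilpotent
    have hmul : ∀ a b : G, ∃ v : G, v ^ p = a ^ p * b ^ p := by
      intro a b
      rcases mul_comm_or_zpowers_sup_ne_top hG (a * b) with hab | hne
      · exact ⟨a * b, (show Commute a b from hab a b).mul_pow p⟩
      set H := Subgroup.zpowers (a * b) ⊔ sgPow ⊤ p with hH
      have hd : ⁅b⁻¹, a⁻¹⁆ ∈ sgPow (⊤ : Subgroup G) p :=
        h (Subgroup.commutator_mem_commutator (Subgroup.mem_top _) (Subgroup.mem_top _))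
      have hd' : ∀ g, ⁅⁅b⁻¹, a⁻¹⁆, g⁆ ∈ sgPow (sgPow (⊤ : Subgroup G) p) p := fun g =>
        commutator_sgPowIter_le hp h 1
          (Subgroup.commutator_mem_commutator hd (Subgroup.mem_top g))
      obtain ⟨m, hm, e⟩ := mul_pow_mem_of_odd hp (sgPow (sgPow (⊤ : Subgroup G) p) p)
        (pow_mem_sgPow hd p) (hd' a) (hd' b)
      have hmem : a ^ p * b ^ p ∈ sgPow H p := by
        rw [eq_mul_inv_of_mul_eq e.symm]
        exact mul_mem (pow_mem_sgPow (Subgroup.mem_sup_left (Subgroup.mem_zpowers _)) p)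
          (inv_mem (sgPow_mono le_sup_right p hm))
      have htop : sgPow H p = (sgPow (⊤ : Subgroup H) p).map H.subtype := by
        rw [map_sgPow, ← MonoidHom.range_eq_map, H.range_subtype]
      obtain ⟨w, hw, hwe⟩ := htop ▸ hmem
      obtain ⟨v, rfl⟩ := ih (Nat.card H) (hn ▸ lt_of_le_of_ne H.card_le_card_group
        (fun e => hne (H.eq_top_of_card_eq e))) H rfl (hG.to_subgroup H)
        (commutator_top_le_sgPow_top (commutator_zpowers_sup_le hp h (a * b))) w hw
      exact ⟨v, hwe⟩
    induction hx using Subgroup.closure_induction with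
    | mem _ hx => obtain ⟨v, -, e⟩ := hx; exact ⟨v, e⟩
    | one => exact ⟨1, one_pow p⟩
    | mul _ _ _ _ ha hb => obtain ⟨a, rfl⟩ := ha; obtain ⟨b, rfl⟩ := hb; exact hmul a b
    | inv _ _ ha => obtain ⟨a, rfl⟩ := ha; exact ⟨a⁻¹, inv_pow a p⟩

lemma exists_pow_eq_of_mem_sgPowIter {G : Type*} [Group G] [Finite G] {p : ℕ} [Fact p.Prime]
    (hp : Odd p) (hG : IsPGroup p G) (h : ⁅(⊤ : Subgroup G), (⊤ : Subgroup G)⁆ ≤ sgPow ⊤ p)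
    {j : ℕ} {x : G} (hx : x ∈ sgPowIter G p (j + 1)) : ∃ v ∈ sgPowIter G p j, v ^ p = x := by
  have := hG.isNilpotent
  set H := sgPowIter G p j
  have hH : ⁅H, H⁆ ≤ sgPow H p :=
    (Subgroup.commutator_mono le_rfl le_top).trans (commutator_sgPowIter_le hp h j)
  have htop : sgPow H p = (sgPow (⊤ : Subgroup H) p).map H.subtype := by
    rw [map_sgPow, ← MonoidHom.range_eq_map, H.range_subtype]
  obtain ⟨w, hw, rfl⟩ : x ∈ (sgPow (⊤ : Subgroup H) p).map H.subtype := htop ▸ hx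
  obtain ⟨v, rfl⟩ := exists_pow_eq_of_mem_sgPow p hp _ H rfl (hG.to_subgroup H)
    (commutator_top_le_sgPow_top hH) w hw
  exact ⟨v, v.2, rfl⟩

lemma pow_pow_eq_one_of_le {G : Type*} [Monoid G] {p a b : ℕ} (h : a ≤ b) {x : G}
    (hx : x ^ p ^ a = 1) : x ^ p ^ b = 1 := by
  obtain ⟨c, rfl⟩ := Nat.exists_eq_add_of_le h
  rw [pow_add, pow_mul, hx, one_pow]

lemma pow_mem_sgPowIter {G : Type*} [Group G] {n j : ℕ} {x : G} (hx : x ∈ sgPowIter G n j) :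
    x ^ n ∈ sgPowIter G n (j + 1) :=
  pow_mem_sgPow hx n

/-- For every `b`, the elements of `H` of order dividing `p ^ b` are closed under products. -/
def OrderClosed {G : Type*} [Group G] (p : ℕ) (H : Subgroup G) : Prop :=
  ∀ b : ℕ, ∀ x ∈ H, ∀ y ∈ H, x ^ p ^ b = 1 → y ^ p ^ b = 1 → (x * y) ^ p ^ b = 1

lemma exists_normal_mem_iff_pow_pow_eq_one {G : Type*} [Group G] {p : ℕ}
    (hH : ∀ g : G, OrderClosed p (Subgroup.zpowers g ⊔ sgPow ⊤ p)) (j b : ℕ) :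
    ∃ M : Subgroup G, M.Normal ∧ ∀ x, x ∈ M ↔ x ∈ sgPowIter G p (j + 1) ∧ x ^ p ^ b = 1 := by
  have hle : sgPowIter G p (j + 1) ≤ Subgroup.zpowers 1 ⊔ sgPow ⊤ p :=
    (sgPowIter_antitone G p (Nat.le_add_left 1 j)).trans le_sup_right
  refine ⟨{ carrier := {x | x ∈ sgPowIter G p (j + 1) ∧ x ^ p ^ b = 1}
            mul_mem' := fun {x y} hx hy =>
              ⟨mul_mem hx.1 hy.1, hH 1 b x (hle hx.1) y (hle hy.1) hx.2 hy.2⟩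
            one_mem' := ⟨one_mem _, one_pow _⟩
            inv_mem' := fun {x} hx => ⟨inv_mem hx.1, by rw [inv_pow, hx.2, inv_one]⟩ },
    ⟨fun x hx g => ⟨(sgPowIter_normal G p (j + 1)).conj_mem x hx.1 g, ?_⟩⟩, fun x => Iff.rfl⟩
  rw [conj_pow, hx.2, mul_one, mul_inv_cancel]

lemma commutator_pow_pow_eq_one {G : Type*} [Group G] {p : ℕ}
    (h : ⁅(⊤ : Subgroup G), (⊤ : Subgroup G)⁆ ≤ sgPow ⊤ p)
    (hH : ∀ g : G, OrderClosed p (Subgroup.zpowers g ⊔ sgPow ⊤ p)) {b : ℕ} {y : G}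
    (hy : y ^ p ^ b = 1) (x : G) : ⁅y, x⁆ ^ p ^ b = 1 := by
  have hym : y ∈ Subgroup.zpowers y ⊔ sgPow ⊤ p :=
    Subgroup.mem_sup_left (Subgroup.mem_zpowers y)
  have hc : ⁅y, x⁆ ∈ Subgroup.zpowers y ⊔ sgPow ⊤ p := Subgroup.mem_sup_right
    (h (Subgroup.commutator_mem_commutator (Subgroup.mem_top y) (Subgroup.mem_top x)))
  have e : ⁅y, x⁆ = y * (x * y⁻¹ * x⁻¹) := by rw [commutatorElement_def]; group
  have hm : x * y⁻¹ * x⁻¹ ∈ Subgroup.zpowers y ⊔ sgPow ⊤ p := by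
    rw [eq_inv_mul_of_mul_eq e.symm]
    exact mul_mem (inv_mem hym) hc
  rw [e]
  refine hH y b _ hym _ hm hy ?_
  rw [conj_pow, inv_pow, hy, inv_one, mul_one, mul_inv_cancel]

section PowerfulGroup

variable {G : Type*} [Group G] [Finite G] {p : ℕ} [Fact p.Prime]

lemma pow_pow_eq_one_of_mem_sgPowIter (hp : Odd p) (hG : IsPGroup p G)
    (h : ⁅(⊤ : Subgroup G), (⊤ : Subgroup G)⁆ ≤ sgPow ⊤ p) {e : ℕ} (he : ∀ x : G, x ^ p ^ e = 1)
    {j b : ℕ} (hjb : e ≤ j + b) {x : G} (hx : x ∈ sgPowIter G p j) : x ^ p ^ b = 1 := by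
  induction j generalizing b x with
  | zero => exact pow_pow_eq_one_of_le (by omega) (he x)
  | succ j ih =>
    obtain ⟨v, hv, rfl⟩ := exists_pow_eq_of_mem_sgPowIter hp hG h hx
    rw [← pow_mul, ← pow_succ']
    exact ih (by omega) hv

lemma commutator_mem_sgPowIter (hp : Odd p) (hG : IsPGroup p G)
    (h : ⁅(⊤ : Subgroup G), (⊤ : Subgroup G)⁆ ≤ sgPow ⊤ p) {j : ℕ} {x : G}
    (hx : x ∈ sgPowIter G p j) (y : G) : ⁅x, y⁆ ∈ sgPowIter G p (j + 1) := by
  have := hG.isNilpotent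
  exact commutator_sgPowIter_le hp h j
    (Subgroup.commutator_mem_commutator hx (Subgroup.mem_top y))

lemma commutator_pow_pow_eq_one_of_mem_sgPowIter (hp : Odd p) (hG : IsPGroup p G)
    (h : ⁅(⊤ : Subgroup G), (⊤ : Subgroup G)⁆ ≤ sgPow ⊤ p)
    (hH : ∀ g : G, OrderClosed p (Subgroup.zpowers g ⊔ sgPow ⊤ p)) {j b : ℕ} {x y : G}
    (hxj : x ∈ sgPowIter G p j) (hx : x ^ p ^ (b + 1) = 1) (hy : y ^ p ^ (b + j) = 1) :
    ⁅x, y⁆ ^ p ^ b = 1 := by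
  obtain ⟨e, he⟩ := isPGroup_iff_exists_pow_pow_eq_one.mp hG
  obtain ⟨k, hk⟩ : ∃ k, e ≤ j + b + k := ⟨e, Nat.le_add_left _ _⟩
  induction k generalizing j b x y with
  | zero =>
    exact pow_pow_eq_one_of_mem_sgPowIter hp hG h he (by omega)
      (commutator_mem_sgPowIter hp hG h hxj y)
  | succ k ihk =>
    induction j generalizing b x y with
    | zero =>
      rw [← commutatorElement_inv, inv_pow, commutator_pow_pow_eq_one h hH (b := b) hy, inv_one]
    | succ j ihj =>
      obtain ⟨v, hv, rfl⟩ := exists_pow_eq_of_mem_sgPowIter hp hG h hxj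
      rw [← pow_mul, ← pow_succ'] at hx
      obtain ⟨M, hM, hMiff⟩ := exists_normal_mem_iff_pow_pow_eq_one hH (j + 1) b
      have hc : ⁅v, y⁆ ∈ sgPowIter G p (j + 1) := commutator_mem_sgPowIter hp hG h hv y
      have hc1 : ⁅v, y⁆ ^ p ^ (b + 1) = 1 := ihj hv hx (by convert hy using 3; omega) (by omega)
      have hd : ⁅⁅v, y⁆⁻¹, v⁆ ∈ sgPowIter G p (j + 2) :=
        commutator_mem_sgPowIter hp hG h (inv_mem hc) v
      have hd1 : ⁅⁅v, y⁆⁻¹, v⁆ ^ p ^ (b + 1) = 1 :=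
        commutator_pow_pow_eq_one h hH (by rw [inv_pow, hc1, inv_one]) v
      have hdM : ∀ g : G, g ^ p ^ (b + (j + 2)) = 1 → ⁅⁅⁅v, y⁆⁻¹, v⁆, g⁆ ∈ M := fun g hg =>
        (hMiff _).mpr ⟨sgPowIter_antitone G p (Nat.le_succ _)
          (commutator_mem_sgPowIter hp hG h hd g), ihk hd hd1 hg (by omega)⟩
      refine ((hMiff _).mp (commutator_pow_mem_of_odd hp M ((hMiff _).mpr
        ⟨pow_mem_sgPowIter hc, ?_⟩) (hdM v ?_) (hdM _ ?_))).2
      · rw [← pow_mul, ← pow_succ', hc1]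
      · exact pow_pow_eq_one_of_le (by omega) hx
      · exact pow_pow_eq_one_of_le (by omega) hc1

lemma orderClosed_top_of_zpowers_sup (hp : Odd p) (hG : IsPGroup p G)
    (h : ⁅(⊤ : Subgroup G), (⊤ : Subgroup G)⁆ ≤ sgPow ⊤ p)
    (hH : ∀ g : G, OrderClosed p (Subgroup.zpowers g ⊔ sgPow ⊤ p)) :
    OrderClosed p (⊤ : Subgroup G) := by
  intro b x _ y _ hx hy
  cases b with
  | zero =>
    rw [pow_zero, pow_one] at *
    rw [hx, hy, mul_one]
  | succ b =>
    obtain ⟨M, hM, hMiff⟩ := exists_normal_mem_iff_pow_pow_eq_one hH 0 b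
    have hd : ⁅y⁻¹, x⁻¹⁆ ∈ sgPowIter G p 1 :=
      commutator_mem_sgPowIter hp hG h (j := 0) (Subgroup.mem_top _) _
    have hd1 : ⁅y⁻¹, x⁻¹⁆ ^ p ^ (b + 1) = 1 :=
      commutator_pow_pow_eq_one h hH (by rw [inv_pow, hy, inv_one]) _
    have hdM : ∀ g : G, g ^ p ^ (b + 1) = 1 → ⁅⁅y⁻¹, x⁻¹⁆, g⁆ ∈ M := fun g hg =>
      (hMiff _).mpr ⟨sgPowIter_antitone G p (Nat.le_succ _)
        (commutator_mem_sgPowIter hp hG h hd g),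
        commutator_pow_pow_eq_one_of_mem_sgPowIter hp hG h hH hd hd1 hg⟩
    have hpow : ∀ g : G, g ^ p ^ (b + 1) = 1 → g ^ p ∈ M := fun g hg =>
      (hMiff _).mpr ⟨pow_mem_sgPowIter (j := 0) (Subgroup.mem_top g), by
        rw [← pow_mul, ← pow_succ', hg]⟩
    obtain ⟨m, hm, e⟩ := mul_pow_mem_of_odd hp M (hpow _ hd1) (hdM x hx) (hdM y hy)
    rw [pow_succ', pow_mul, e]
    exact ((hMiff _).mp (mul_mem (mul_mem (hpow x hx) (hpow y hy)) hm)).2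

end PowerfulGroup

lemma orderClosed_top (p : ℕ) [Fact p.Prime] (hp : Odd p) (n : ℕ) :
    ∀ (G : Type*) [Group G] [Finite G], Nat.card G = n → IsPGroup p G →
      ⁅(⊤ : Subgroup G), (⊤ : Subgroup G)⁆ ≤ sgPow ⊤ p → OrderClosed p (⊤ : Subgroup G) := by
  induction n using Nat.strong_induction_on with
  | _ n ih =>
    intro G _ _ hn hG h
    have := hG.isNilpotent
    refine orderClosed_top_of_zpowers_sup hp hG h fun g => ?_
    rcases mul_comm_or_zpowers_sup_ne_top hG g with hab | hne
    · intro b x _ y _ hx hy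
      rw [(show Commute x y from hab x y).mul_pow, hx, hy, one_mul]
    · set H := Subgroup.zpowers g ⊔ sgPow ⊤ p
      have hcl := ih (Nat.card H) (hn ▸ lt_of_le_of_ne H.card_le_card_group
        (fun e => hne (H.eq_top_of_card_eq e))) H rfl (hG.to_subgroup H)
        (commutator_top_le_sgPow_top (commutator_zpowers_sup_le hp h g))
      intro b x hx y hy hxb hyb
      exact congrArg Subtype.val (hcl b ⟨x, hx⟩ (Subgroup.mem_top _) ⟨y, hy⟩ (Subgroup.mem_top _)
        (Subtype.ext hxb) (Subtype.ext hyb))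

/-- if G is a powerful p-group (p odd), N ≤ G^p and N has exponent at most p²,
then every element of order p in N is central in N. -/
theorem stmt2 {G : Type*} [Group G] [Finite G] (p : ℕ) (hp : p.Prime) (hodd : Odd p)
    (hpG : IsPGroup p G)
    (hpowerful : ⁅(⊤ : Subgroup G), (⊤ : Subgroup G)⁆ ≤ sgPow ⊤ p)
    (N : Subgroup G) (hNle : N ≤ sgPow ⊤ p)
    (hexp : ∀ x ∈ N, x ^ p ^ 2 = 1)
    (x : G) (hx : x ∈ N) (hxord : orderOf x = p) :
    ∀ y ∈ N, Commute x y := by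
  have : Fact p.Prime := ⟨hp⟩
  have hcl := orderClosed_top p hodd _ G rfl hpG hpowerful
  have hH : ∀ g : G, OrderClosed p (Subgroup.zpowers g ⊔ sgPow ⊤ p) := fun g b a _ c _ =>
    hcl b a (Subgroup.mem_top a) c (Subgroup.mem_top c)
  intro y hy
  obtain ⟨g, -, rfl⟩ := exists_pow_eq_of_mem_sgPowIter hodd hpG hpowerful (j := 0) (hNle hy)
  have hg : g ^ p ^ 3 = 1 := by rw [pow_succ', pow_mul]; exact hexp _ hy
  have hx1 : x ^ p ^ 1 = 1 := by rw [pow_one, ← hxord, pow_orderOf_eq_one]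
  have hc : ⁅g, x⁆ ∈ sgPowIter G p 2 := by
    rw [← commutatorElement_inv]
    exact inv_mem (commutator_mem_sgPowIter hodd hpG hpowerful (j := 1) (hNle hx) g)
  have hc1 : ⁅g, x⁆ ^ p ^ 1 = 1 := by
    rw [← commutatorElement_inv, inv_pow, commutator_pow_pow_eq_one hpowerful hH hx1, inv_one]
  have hd : ⁅⁅g, x⁆⁻¹, g⁆ ∈ sgPowIter G p 3 :=
    commutator_mem_sgPowIter hodd hpG hpowerful (inv_mem hc) g
  have hd1 : ⁅⁅g, x⁆⁻¹, g⁆ ^ p ^ 1 = 1 :=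
    commutator_pow_pow_eq_one hpowerful hH (by rw [inv_pow, hc1, inv_one]) g
  have hcomm : ∀ z : G, z ^ p ^ 3 = 1 → Commute ⁅⁅g, x⁆⁻¹, g⁆ z := fun z hz => by
    rw [← commutatorElement_eq_one_iff_commute]
    simpa using commutator_pow_pow_eq_one_of_mem_sgPowIter hodd hpG hpowerful hH (b := 0) hd hd1
      (by simpa using hz)
  exact (commutatorElement_eq_one_iff_commute.mp (commutator_pow_eq_one_of_odd hodd
    (by simpa using hc1) (hcomm g hg)
    (hcomm _ (pow_pow_eq_one_of_le (by omega) hc1)))).symm
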